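/- Define H̄(p) = inf_{φ∈S} esssup_{ω∈Ω} sup_{x∈ℤ^d} 𝓗(φ,p,x,ω) for p ∈ ℝ^d. Then: (i) |p|_∞/b ≤ H̄(p) ≤ |p|_∞/a for every p ∈ ℝ^d, and in particular H̄(p) = 0 if and only if p = 0; (ii) H̄(λp) = λ·H̄(p) for every λ > 0 and p ∈ ℝ^d; (iii) H̄(p+q) ≤ H̄(p) + H̄(q) for all p, q ∈ ℝ^d. -/

import Mathlib

open MeasureTheory Filter

noncomputable section

/-- The set `A` of signed standard basis vectors of `ℤ^d`. -/
def dirs (d : ℕ) : Finset (Fin d → ℤ) :=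
  Finset.univ.image (fun ib : Fin d × Bool =>
    if ib.2 then Pi.single ib.1 1 else -Pi.single ib.1 1)

/-- The inner product `p·α` of `p ∈ ℝ^d` with a lattice vector `α ∈ ℤ^d`. -/
def pdot {d : ℕ} (p : Fin d → ℝ) (α : Fin d → ℤ) : ℝ := ∑ i, p i * (α i : ℝ)

/-- The `ℓ∞` norm of `p ∈ ℝ^d`. -/
def linf {d : ℕ} (p : Fin d → ℝ) : ℝ := ⨆ i, |p i|

/-- The `ℓ¹` norm of a lattice point. -/
def zl1 {d : ℕ} (x : Fin d → ℤ) : ℝ := ∑ i, |(x i : ℝ)|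

/-- The discrete Hamiltonian `𝓗(φ,p,x) = max_{α∈A} (−𝒟φ(x,α) − p·α)/τ(x,α)`. -/
def ham {d : ℕ} (τ : (Fin d → ℤ) → (Fin d → ℤ) → ℝ) (p : Fin d → ℝ)
    (φ : (Fin d → ℤ) → ℝ) (x : Fin d → ℤ) : ℝ :=
  sSup {r : ℝ | ∃ α ∈ dirs d, r = (-(φ (x + α) - φ x) - pdot p α) / τ x α}

/-- `v` is a nearest-neighbor path of length `k` starting at `x`. -/
def IsPath {d : ℕ} (x : Fin d → ℤ) (k : ℕ) (v : ℕ → Fin d → ℤ) : Prop :=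
  v 0 = x ∧ ∀ i < k, v (i + 1) - v i ∈ dirs d

/-- Total weight (travel time) of the first `k` steps of a path. -/
def pathWeight {d : ℕ} (τ : (Fin d → ℤ) → (Fin d → ℤ) → ℝ) (k : ℕ)
    (v : ℕ → Fin d → ℤ) : ℝ :=
  ∑ i ∈ Finset.range k, τ (v i) (v (i + 1) - v i)

/-- Total running cost `Σ p·(v_{i+1} − v_i)` of the first `k` steps of a path. -/
def pathCost {d : ℕ} (p : Fin d → ℝ) (k : ℕ) (v : ℕ → Fin d → ℤ) : ℝ :=
  ∑ i ∈ Finset.range k, pdot p (v (i + 1) - v i)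

/-- The discrete finite time-horizon value function `μ(x,t)`. -/
def valueFn {d : ℕ} (τ : (Fin d → ℤ) → (Fin d → ℤ) → ℝ) (p : Fin d → ℝ)
    (φ : (Fin d → ℤ) → ℝ) (x : Fin d → ℤ) (t : ℝ) : ℝ :=
  sInf {r : ℝ | ∃ (k : ℕ) (v : ℕ → Fin d → ℤ), IsPath x k v ∧
    pathWeight τ k v ≤ t ∧ r = pathCost p k v + φ (v k)}

/-- The class `S` of jointly measurable functions `φ : ℤ^d × Ω → ℝ` with stationary,
integrable, mean-zero discrete derivatives. -/
def Sclass (d : ℕ) {Ω : Type*} [MeasurableSpace Ω] (P : Measure Ω)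
    (V : (Fin d → ℤ) → Ω → Ω) : Set ((Fin d → ℤ) → Ω → ℝ) :=
  {φ | (∀ x, Measurable (φ x)) ∧
    (∀ x z α, ∀ᵐ ω ∂P,
      φ (x + z + α) ω - φ (x + z) ω = φ (x + α) (V z ω) - φ x (V z ω)) ∧
    (∀ x α, Integrable (fun ω => φ (x + α) ω - φ x ω) P) ∧
    (∀ x α, ∫ ω, (φ (x + α) ω - φ x ω) ∂P = 0)}

/-- The effective Hamiltonian `H̄(p) = inf_{φ∈S} esssup_ω sup_x 𝓗(φ,p,x,ω)`. -/
def Hbar (d : ℕ) {Ω : Type*} [MeasurableSpace Ω] (P : Measure Ω)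
    (V : (Fin d → ℤ) → Ω → Ω)
    (τ : (Fin d → ℤ) → (Fin d → ℤ) → Ω → ℝ) (p : Fin d → ℝ) : EReal :=
  ⨅ φ ∈ Sclass d P V,
    essSup (fun ω => ⨆ x : Fin d → ℤ,
      ((ham (fun y α => τ y α ω) p (fun y => φ y ω) x : ℝ) : EReal)) P

lemma single_mem_dirs {d : ℕ} (i : Fin d) : (Pi.single i 1 : Fin d → ℤ) ∈ dirs d :=
  Finset.mem_image.2 ⟨(i, true), Finset.mem_univ _, rfl⟩

lemma neg_single_mem_dirs {d : ℕ} (i : Fin d) : (-Pi.single i 1 : Fin d → ℤ) ∈ dirs d :=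
  Finset.mem_image.2 ⟨(i, false), Finset.mem_univ _, rfl⟩

lemma pdot_single {d : ℕ} (p : Fin d → ℝ) (i : Fin d) : pdot p (Pi.single i 1) = p i := by
  simp [pdot, Pi.single_apply]

lemma pdot_neg {d : ℕ} (p : Fin d → ℝ) (α : Fin d → ℤ) : pdot p (-α) = -pdot p α := by
  simp [pdot]

lemma pdot_add_left {d : ℕ} (p q : Fin d → ℝ) (α : Fin d → ℤ) :
    pdot (p + q) α = pdot p α + pdot q α := by
  simp [pdot, add_mul, Finset.sum_add_distrib]

lemma pdot_smul_left {d : ℕ} (l : ℝ) (p : Fin d → ℝ) (α : Fin d → ℤ) :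
    pdot (l • p) α = l * pdot p α := by
  simp [pdot, Finset.mul_sum, mul_assoc]

lemma abs_le_linf {d : ℕ} (p : Fin d → ℝ) (i : Fin d) : |p i| ≤ linf p :=
  le_ciSup (f := fun i => |p i|) (Set.finite_range _).bddAbove i

lemma linf_nonneg {d : ℕ} (p : Fin d → ℝ) : 0 ≤ linf p :=
  Real.iSup_nonneg fun _ => abs_nonneg _

lemma linf_eq_zero_iff {d : ℕ} {p : Fin d → ℝ} : linf p = 0 ↔ p = 0 := by
  refine ⟨fun h => funext fun i => ?_, fun h => by simp [h, linf]⟩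
  exact abs_nonpos_iff.1 (h ▸ abs_le_linf p i)

lemma abs_pdot_le_linf {d : ℕ} (p : Fin d → ℝ) {α : Fin d → ℤ} (hα : α ∈ dirs d) :
    |pdot p α| ≤ linf p := by
  obtain ⟨⟨i, s⟩, -, rfl⟩ := Finset.mem_image.1 hα
  cases s <;> simpa [pdot_neg, pdot_single] using abs_le_linf p i

/-- An upper bound on the discrete Hamiltonian is a family of one-sided edge inequalities. -/
lemma ham_le_iff {d : ℕ} (hd : 1 ≤ d) {τ : (Fin d → ℤ) → (Fin d → ℤ) → ℝ} {p : Fin d → ℝ}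
    {φ : (Fin d → ℤ) → ℝ} {x : Fin d → ℤ} (hτ : ∀ α ∈ dirs d, 0 < τ x α) {c : ℝ} :
    ham τ p φ x ≤ c ↔ ∀ α ∈ dirs d, -(φ (x + α) - φ x) - pdot p α ≤ c * τ x α := by
  have hset : {r : ℝ | ∃ α ∈ dirs d, r = (-(φ (x + α) - φ x) - pdot p α) / τ x α} =
      (fun α => (-(φ (x + α) - φ x) - pdot p α) / τ x α) '' (dirs d : Set (Fin d → ℤ)) := by
    ext r
    simp [eq_comm]
  have hne : (dirs d : Set (Fin d → ℤ)).Nonempty := ⟨_, single_mem_dirs ⟨0, hd⟩⟩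
  rw [ham, hset, csSup_le_iff ((dirs d).finite_toSet.image _).bddAbove (hne.image _),
    Set.forall_mem_image]
  exact forall₂_congr fun α hα => div_le_iff₀ (hτ α hα)

lemma zero_mem_Sclass (d : ℕ) {Ω : Type*} [MeasurableSpace Ω] (P : Measure Ω)
    (V : (Fin d → ℤ) → Ω → Ω) : (fun _ _ => 0) ∈ Sclass d P V := by
  simp [Sclass, measurable_const]

lemma add_mem_Sclass {d : ℕ} {Ω : Type*} [MeasurableSpace Ω] {P : Measure Ω}
    {V : (Fin d → ℤ) → Ω → Ω} {φ ψ : (Fin d → ℤ) → Ω → ℝ}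
    (hφ : φ ∈ Sclass d P V) (hψ : ψ ∈ Sclass d P V) :
    (fun x ω => φ x ω + ψ x ω) ∈ Sclass d P V := by
  obtain ⟨m, s, i, e⟩ := hφ
  obtain ⟨m', s', i', e'⟩ := hψ
  have key : ∀ x α, (fun ω => φ (x + α) ω + ψ (x + α) ω - (φ x ω + ψ x ω)) =
      fun ω => (φ (x + α) ω - φ x ω) + (ψ (x + α) ω - ψ x ω) := fun x α => by
    funext ω
    ring
  refine ⟨fun x => (m x).add (m' x), fun x z α => ?_, fun x α => ?_, fun x α => ?_⟩
  · filter_upwards [s x z α, s' x z α] with ω h h'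
    linarith
  · rw [key]
    exact (i x α).add (i' x α)
  · rw [key, integral_add (i x α) (i' x α), e, e', add_zero]

lemma smul_mem_Sclass {d : ℕ} {Ω : Type*} [MeasurableSpace Ω] {P : Measure Ω}
    {V : (Fin d → ℤ) → Ω → Ω} {φ : (Fin d → ℤ) → Ω → ℝ} (l : ℝ)
    (hφ : φ ∈ Sclass d P V) : (fun x ω => l * φ x ω) ∈ Sclass d P V := by
  obtain ⟨m, s, i, e⟩ := hφ
  refine ⟨fun x => (m x).const_mul l, fun x z α => ?_, fun x α => ?_, fun x α => ?_⟩
  · filter_upwards [s x z α] with ω h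
    rw [← mul_sub, ← mul_sub, h]
  · simpa only [mul_sub] using (i x α).const_mul l
  · simp only [← mul_sub]
    rw [integral_const_mul, e, mul_zero]

/-- The real levels `c` at which some `φ ∈ S` is a subsolution of `𝓗(φ, p) ≤ c`. -/
def subsolutionLevels (d : ℕ) {Ω : Type*} [MeasurableSpace Ω] (P : Measure Ω)
    (V : (Fin d → ℤ) → Ω → Ω) (τ : (Fin d → ℤ) → (Fin d → ℤ) → Ω → ℝ) (p : Fin d → ℝ) : Set ℝ :=
  {c | ∃ φ ∈ Sclass d P V, ∀ᵐ ω ∂P, ∀ x, ∀ α ∈ dirs d,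
    -(φ (x + α) ω - φ x ω) - pdot p α ≤ c * τ x α ω}

section

variable {d : ℕ} {a b : ℝ} {Ω : Type*} [MeasurableSpace Ω] {P : Measure Ω}
  {V : (Fin d → ℤ) → Ω → Ω} {τ : (Fin d → ℤ) → (Fin d → ℤ) → Ω → ℝ}

lemma add_mem_subsolutionLevels {p q : Fin d → ℝ} {c e : ℝ}
    (hc : c ∈ subsolutionLevels d P V τ p) (he : e ∈ subsolutionLevels d P V τ q) :
    c + e ∈ subsolutionLevels d P V τ (p + q) := by
  obtain ⟨φ, hφ, h⟩ := hc
  obtain ⟨ψ, hψ, h'⟩ := he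
  refine ⟨_, add_mem_Sclass hφ hψ, ?_⟩
  filter_upwards [h, h'] with ω h h' x α hα
  have := h x α hα
  have := h' x α hα
  rw [pdot_add_left]
  linarith

lemma mul_mem_subsolutionLevels {p : Fin d → ℝ} {c l : ℝ} (hl : 0 ≤ l)
    (hc : c ∈ subsolutionLevels d P V τ p) :
    l * c ∈ subsolutionLevels d P V τ (l • p) := by
  obtain ⟨φ, hφ, h⟩ := hc
  refine ⟨_, smul_mem_Sclass l hφ, ?_⟩
  filter_upwards [h] with ω h x α hα
  have := mul_le_mul_of_nonneg_left (h x α hα) hl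
  rw [pdot_smul_left]
  linarith

lemma linf_div_mem_subsolutionLevels (ha : 0 < a)
    (hτ : ∀ᵐ ω ∂P, ∀ x, ∀ α ∈ dirs d, a ≤ τ x α ω) (p : Fin d → ℝ) :
    linf p / a ∈ subsolutionLevels d P V τ p := by
  refine ⟨_, zero_mem_Sclass d P V, ?_⟩
  filter_upwards [hτ] with ω h x α hα
  have h1 : linf p / a * a ≤ linf p / a * τ x α ω :=
    mul_le_mul_of_nonneg_left (h x α hα) (div_nonneg (linf_nonneg p) ha.le)
  rw [div_mul_cancel₀ _ ha.ne'] at h1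
  have := neg_le_of_abs_le (abs_pdot_le_linf p hα)
  linarith

/-- Averaging the edge inequality at the origin, where `𝒟φ` has mean zero. -/
lemma neg_pdot_le_of_edge_bound [IsProbabilityMeasure P] {φ : (Fin d → ℤ) → Ω → ℝ}
    (hφ : φ ∈ Sclass d P V) {p : Fin d → ℝ} {α : Fin d → ℤ} {K : ℝ}
    (h : ∀ᵐ ω ∂P, -(φ (0 + α) ω - φ 0 ω) - pdot p α ≤ K) : -pdot p α ≤ K := by
  obtain ⟨-, -, i, e⟩ := hφ
  have key := integral_mono_ae (((i 0 α).neg).sub (integrable_const (pdot p α)))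
    (integrable_const K) h
  rw [integral_sub' (i 0 α).neg (integrable_const _), integral_neg', e] at key
  simpa using key

lemma linf_div_le_of_mem_subsolutionLevels [IsProbabilityMeasure P] (hd : 1 ≤ d) (ha : 0 < a)
    (hab : a ≤ b)
    (hτ : ∀ᵐ ω ∂P, ∀ x, ∀ α ∈ dirs d, a ≤ τ x α ω ∧ τ x α ω ≤ b) {p : Fin d → ℝ} {c : ℝ}
    (hc : c ∈ subsolutionLevels d P V τ p) : linf p / b ≤ c := by
  obtain ⟨φ, hφ, h⟩ := hc
  have abs_le_of_bound : ∀ K, (∀ t, a ≤ t → t ≤ b → c * t ≤ K) → ∀ i, |p i| ≤ K := by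
    intro K hK i
    have aux : ∀ α ∈ dirs d, -pdot p α ≤ K := fun α hα =>
      neg_pdot_le_of_edge_bound hφ <| by
        filter_upwards [h, hτ] with ω h hτ
        exact (h 0 α hα).trans (hK _ (hτ 0 α hα).1 (hτ 0 α hα).2)
    have h1 := aux _ (single_mem_dirs i)
    have h2 := aux _ (neg_single_mem_dirs i)
    rw [pdot_single] at h1
    rw [pdot_neg, pdot_single, neg_neg] at h2
    exact abs_le.2 ⟨by linarith, h2⟩
  have hc0 : 0 ≤ c := by
    by_contra! hneg
    have := abs_le_of_bound (c * a) (fun t ht _ => mul_le_mul_of_nonpos_left ht hneg.le) ⟨0, hd⟩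
    linarith [abs_nonneg (p ⟨0, hd⟩), mul_neg_of_neg_of_pos hneg ha]
  rw [div_le_iff₀ (ha.trans_le hab)]
  exact Real.iSup_le (abs_le_of_bound _ fun t _ ht => mul_le_mul_of_nonneg_left ht hc0)
    (mul_nonneg hc0 (ha.le.trans hab))

lemma essSup_ham_le_iff (hd : 1 ≤ d) (ha : 0 < a)
    (hτ : ∀ᵐ ω ∂P, ∀ x, ∀ α ∈ dirs d, a ≤ τ x α ω) {φ : (Fin d → ℤ) → Ω → ℝ} {p : Fin d → ℝ}
    {c : ℝ} :
    essSup (fun ω => ⨆ x : Fin d → ℤ,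
      ((ham (fun y α => τ y α ω) p (fun y => φ y ω) x : ℝ) : EReal)) P ≤ (c : EReal) ↔
    ∀ᵐ ω ∂P, ∀ x, ∀ α ∈ dirs d, -(φ (x + α) ω - φ x ω) - pdot p α ≤ c * τ x α ω := by
  have hpt : ∀ᵐ ω ∂P, ((⨆ x : Fin d → ℤ,
      ((ham (fun y α => τ y α ω) p (fun y => φ y ω) x : ℝ) : EReal)) ≤ (c : EReal) ↔
      ∀ x, ∀ α ∈ dirs d, -(φ (x + α) ω - φ x ω) - pdot p α ≤ c * τ x α ω) := by
    filter_upwards [hτ] with ω hτ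
    rw [iSup_le_iff]
    refine forall_congr' fun x => ?_
    rw [EReal.coe_le_coe_iff, ham_le_iff hd fun α hα => ha.trans_le (hτ x α hα)]
  rw [← eventually_congr hpt]
  exact ⟨fun h => (ae_le_essSup).mono fun ω hω => hω.trans h, fun h => essSup_le_of_ae_le _ h⟩

/-- `H̄(p)` is finite, and is the infimum of the subsolution levels. -/
lemma exists_Hbar_eq_coe_isGLB [IsProbabilityMeasure P] (hd : 1 ≤ d) (ha : 0 < a) (hab : a ≤ b)
    (hτ : ∀ᵐ ω ∂P, ∀ x, ∀ α ∈ dirs d, a ≤ τ x α ω ∧ τ x α ω ≤ b) (p : Fin d → ℝ) :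
    ∃ h : ℝ, Hbar d P V τ p = h ∧ IsGLB (subsolutionLevels d P V τ p) h := by
  have hτa : ∀ᵐ ω ∂P, ∀ x, ∀ α ∈ dirs d, a ≤ τ x α ω :=
    hτ.mono fun ω h x α hα => (h x α hα).1
  have hle : ∀ c ∈ subsolutionLevels d P V τ p, Hbar d P V τ p ≤ c := by
    rintro c ⟨φ, hφ, h⟩
    exact iInf₂_le_of_le φ hφ ((essSup_ham_le_iff hd ha hτa).2 h)
  have hlt : ∀ c : ℝ, Hbar d P V τ p < c → c ∈ subsolutionLevels d P V τ p := by
    intro c hc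
    obtain ⟨φ, h⟩ := iInf_lt_iff.1 hc
    obtain ⟨hφ, h⟩ := iInf_lt_iff.1 h
    exact ⟨φ, hφ, (essSup_ham_le_iff hd ha hτa).1 h.le⟩
  have hbot : ((linf p / b : ℝ) : EReal) ≤ Hbar d P V τ p :=
    EReal.le_of_forall_lt_iff_le.1 fun c hc => EReal.coe_le_coe_iff.2 <|
      linf_div_le_of_mem_subsolutionLevels hd ha hab hτ (hlt c hc)
  have htop := hle _ (linf_div_mem_subsolutionLevels ha hτa p)
  obtain ⟨h, hh⟩ : ∃ h : ℝ, (h : EReal) = Hbar d P V τ p :=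
    ⟨_, EReal.coe_toReal (htop.trans_lt (EReal.coe_lt_top _)).ne
      ((EReal.bot_lt_coe _).trans_le hbot).ne'⟩
  rw [← hh] at hle hlt
  refine ⟨h, hh.symm, fun c hc => EReal.coe_le_coe_iff.1 (hle c hc), fun m hm => ?_⟩
  exact le_of_forall_gt_imp_ge_of_dense fun c hc => hm (hlt c (EReal.coe_lt_coe_iff.2 hc))

end

/-- `H̄` satisfies `|p|_∞/b ≤ H̄(p) ≤ |p|_∞/a` (so `H̄(p) = 0 ↔ p = 0`),
is positively 1-homogeneous, and subadditive: it is a norm on `ℝ^d`. -/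
theorem stmt1 {d : ℕ} (hd : 1 ≤ d) {a b : ℝ} (ha : 0 < a) (hab : a ≤ b)
    {Ω : Type*} [MeasurableSpace Ω] (P : Measure Ω) [IsProbabilityMeasure P]
    (V : (Fin d → ℤ) → Ω → Ω)
    (hVmp : ∀ z, MeasurePreserving (V z) P P)
    (hV0 : V 0 = id) (hVadd : ∀ z w, V (z + w) = V z ∘ V w)
    (τ : (Fin d → ℤ) → (Fin d → ℤ) → Ω → ℝ)
    (hτmeas : ∀ x α, Measurable (τ x α))
    (hτstat : ∀ x z α, ∀ᵐ ω ∂P, τ (x + z) α ω = τ x α (V z ω))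
    (hτbd : ∀ᵐ ω ∂P, ∀ x, ∀ α ∈ dirs d, a ≤ τ x α ω ∧ τ x α ω ≤ b) :
    (∀ p : Fin d → ℝ,
        ((linf p / b : ℝ) : EReal) ≤ Hbar d P V τ p ∧
        Hbar d P V τ p ≤ ((linf p / a : ℝ) : EReal) ∧
        (Hbar d P V τ p = 0 ↔ p = 0)) ∧
    (∀ (l : ℝ), 0 < l → ∀ p : Fin d → ℝ,
        Hbar d P V τ (l • p) = ((l : ℝ) : EReal) * Hbar d P V τ p) ∧
    (∀ p q : Fin d → ℝ,
        Hbar d P V τ (p + q) ≤ Hbar d P V τ p + Hbar d P V τ q) := by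
  have hτa : ∀ᵐ ω ∂P, ∀ x, ∀ α ∈ dirs d, a ≤ τ x α ω :=
    hτbd.mono fun ω h x α hα => (h x α hα).1
  choose h hH hglb using exists_Hbar_eq_coe_isGLB (V := V) hd ha hab hτbd
  simp only [hH, ← EReal.coe_mul, ← EReal.coe_add, EReal.coe_le_coe_iff, EReal.coe_eq_coe_iff,
    EReal.coe_eq_zero]
  have hlow : ∀ p, linf p / b ≤ h p := fun p =>
    (hglb p).2 fun c hc => linf_div_le_of_mem_subsolutionLevels hd ha hab hτbd hc
  have hupp : ∀ p, h p ≤ linf p / a := fun p =>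
    (hglb p).1 (linf_div_mem_subsolutionLevels ha hτa p)
  have hscale : ∀ l : ℝ, 0 < l → ∀ p, h (l • p) ≤ l * h p := fun l hl p => by
    rw [← div_le_iff₀' hl]
    refine (hglb p).2 fun c hc => ?_
    rw [div_le_iff₀' hl]
    exact (hglb _).1 (mul_mem_subsolutionLevels hl.le hc)
  refine ⟨fun p => ⟨hlow p, hupp p, fun h0 => ?_, ?_⟩, fun l hl p => ?_, fun p q => ?_⟩
  · have := hlow p
    rw [h0, div_le_iff₀ (ha.trans_le hab), zero_mul] at this
    exact linf_eq_zero_iff.1 (this.antisymm (linf_nonneg p))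
  · rintro rfl
    have h1 := hlow 0
    have h2 := hupp 0
    rw [linf_eq_zero_iff.2 rfl, zero_div] at h1 h2
    exact h2.antisymm h1
  · refine (hscale l hl p).antisymm ?_
    have := hscale l⁻¹ (inv_pos.2 hl) (l • p)
    rwa [inv_smul_smul₀ hl.ne', le_inv_mul_iff₀ hl] at this
  · rw [← sub_le_iff_le_add]
    refine (hglb p).2 fun c hc => ?_
    rw [sub_le_comm]
    refine (hglb q).2 fun e he => ?_
    rw [sub_le_iff_le_add']
    exact (hglb _).1 (add_mem_subsolutionLevels hc he)
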